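/- arXiv:2509.04099 — 2 statements merged into one kernel-verified Lean document; each statement's English description precedes it below -/
import Mathlib

section
/- Let 0 < a < c and 0 < b < d. Let (u,v) be a positive radial C² solution of the system on [0,R] with central values (a,b) and with u, v nondecreasing. Let (z₁,z₂) be positive C² functions on [0,R] satisfying z₁(r) = c + g(b/f(a) + L_q) ∫₀^r t^{1−n} ∫₀^t s^{n−1} p(s) g(f(z₁(s))) ds dt and z₂(r) = d + f(a/g(b) + L_p) ∫₀^r t^{1−n} ∫₀^t s^{n−1} q(s) f(g(z₂(s))) ds dt. Then u(r) < z₁(r) and v(r) < z₂(r) for all r ∈ [0,R]. -/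
open MeasureTheory Set Filter Topology

noncomputable section

/-- The iterated radial kernel
`∫₀^r t^{1-n} ∫₀^t s^{n-1} w(s) h(φ(s)) ds dt`. -/
def radK (n : ℕ) (w h φ : ℝ → ℝ) (r : ℝ) : ℝ :=
  ∫ t in (0:ℝ)..r, t ^ (1 - (n : ℤ)) *
    ∫ s in (0:ℝ)..t, s ^ ((n : ℤ) - 1) * w s * h (φ s)

/-- Hypothesis (F1). -/
def hypF1 (f g : ℝ → ℝ) : Prop :=
  ContinuousOn f (Ici 0) ∧ ContinuousOn g (Ici 0) ∧
  DifferentiableOn ℝ f (Ioi 0) ∧ DifferentiableOn ℝ g (Ioi 0) ∧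
  MonotoneOn f (Ici 0) ∧ MonotoneOn g (Ici 0) ∧
  f 0 = 0 ∧ g 0 = 0 ∧ (∀ s : ℝ, 0 < s → 0 < f s) ∧ (∀ s : ℝ, 0 < s → 0 < g s)

/-- Hypothesis (F2): multiplicative subadditivity. -/
def hypF2 (f g : ℝ → ℝ) : Prop :=
  (∀ s : ℝ, 0 ≤ s → ∀ r : ℝ, 0 ≤ r → f (s * r) ≤ f s * f r) ∧
  (∀ l : ℝ, 0 ≤ l → ∀ t : ℝ, 0 ≤ t → g (l * t) ≤ g l * g t)

/-- Hypothesis (F3): finite Keller–Osserman integrals. -/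
def hypF3 (f g : ℝ → ℝ) : Prop :=
  IntegrableOn (fun t : ℝ => 1 / Real.sqrt (∫ z in (0:ℝ)..t, g (f z))) (Ioi 1) ∧
  IntegrableOn (fun t : ℝ => 1 / Real.sqrt (∫ z in (0:ℝ)..t, f (g z))) (Ioi 1)

/-- Hypothesis (PQ). -/
def hypPQ (p q : ℝ → ℝ) : Prop :=
  ContinuousOn p (Ici 0) ∧ ContinuousOn q (Ici 0) ∧
  (∀ s : ℝ, 0 ≤ s → 0 ≤ p s) ∧ (∀ s : ℝ, 0 ≤ s → 0 ≤ q s) ∧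
  (¬ ∀ s : ℝ, 0 ≤ s → p s = 0 ∧ q s = 0) ∧
  IntegrableOn (fun s : ℝ => s * p s) (Ioi 0) ∧
  IntegrableOn (fun s : ℝ => s * q s) (Ioi 0) ∧
  ¬ ∃ R : ℝ, ∀ s : ℝ, R ≤ s → min (p s) (q s) = 0

/-- `L_w = (1/(n-2)) ∫₀^∞ s w(s) ds`. -/
def Lcoef (n : ℕ) (w : ℝ → ℝ) : ℝ := (1 / ((n : ℝ) - 2)) * ∫ s in Ioi (0:ℝ), s * w s

/-- Keller–Osserman transform `Φ(t) = ∫_t^∞ ds / g(f(s))`. -/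
def PhiKO (f g : ℝ → ℝ) (t : ℝ) : ℝ := ∫ s in Ioi t, 1 / g (f s)

/-- Keller–Osserman transform `Ψ(t) = ∫_t^∞ ds / f(g(s))`. -/
def PsiKO (f g : ℝ → ℝ) (t : ℝ) : ℝ := ∫ s in Ioi t, 1 / f (g s)

/-- Positive radial `C²` solution (integral form) on `[0, ρ)` with central values `(a,b)`. -/
def IsRadSol (n : ℕ) (p q f g : ℝ → ℝ) (a b ρ : ℝ) (u v : ℝ → ℝ) : Prop :=
  ContDiffOn ℝ 2 u (Ico 0 ρ) ∧ ContDiffOn ℝ 2 v (Ico 0 ρ) ∧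
  (∀ r ∈ Ico (0:ℝ) ρ, 0 < u r ∧ 0 < v r) ∧
  (∀ r ∈ Ico (0:ℝ) ρ, u r = a + radK n p g v r) ∧
  (∀ r ∈ Ico (0:ℝ) ρ, v r = b + radK n q f u r)

/-- Positive radial `C²` solution (integral form) on the closed interval `[0, R]`. -/
def IsRadSolIcc (n : ℕ) (p q f g : ℝ → ℝ) (a b R : ℝ) (u v : ℝ → ℝ) : Prop :=
  ContDiffOn ℝ 2 u (Icc 0 R) ∧ ContDiffOn ℝ 2 v (Icc 0 R) ∧
  (∀ r ∈ Icc (0:ℝ) R, 0 < u r ∧ 0 < v r) ∧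
  (∀ r ∈ Icc (0:ℝ) R, u r = a + radK n p g v r) ∧
  (∀ r ∈ Icc (0:ℝ) R, v r = b + radK n q f u r)

/-- Entire positive radial `C²` solution (integral form) with central values `(a,b)`. -/
def IsEntireRadSol (n : ℕ) (p q f g : ℝ → ℝ) (a b : ℝ) (u v : ℝ → ℝ) : Prop :=
  ContDiffOn ℝ 2 u (Ici 0) ∧ ContDiffOn ℝ 2 v (Ici 0) ∧
  (∀ r ∈ Ici (0:ℝ), 0 < u r ∧ 0 < v r) ∧
  (∀ r ∈ Ici (0:ℝ), u r = a + radK n p g v r) ∧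
  (∀ r ∈ Ici (0:ℝ), v r = b + radK n q f u r)

/-- Positive `C²` solution of the radial ODE system on `[0, ρ)` with central values `(a,b)`. -/
def IsRadODESol (n : ℕ) (p q f g : ℝ → ℝ) (a b ρ : ℝ) (u v : ℝ → ℝ) : Prop :=
  ContDiffOn ℝ 2 u (Ico 0 ρ) ∧ ContDiffOn ℝ 2 v (Ico 0 ρ) ∧
  (∀ r ∈ Ico (0:ℝ) ρ, 0 < u r ∧ 0 < v r) ∧
  u 0 = a ∧ v 0 = b ∧ deriv u 0 = 0 ∧ deriv v 0 = 0 ∧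
  (∀ r ∈ Ioo (0:ℝ) ρ,
    deriv (deriv u) r + ((n : ℝ) - 1) / r * deriv u r = p r * g (v r) ∧
    deriv (deriv v) r + ((n : ℝ) - 1) / r * deriv v r = q r * f (u r))

/-- The set `S` of central values admitting an entire positive radial solution. -/
def centralSet (n : ℕ) (p q f g : ℝ → ℝ) : Set (ℝ × ℝ) :=
  {ab : ℝ × ℝ | 0 ≤ ab.1 ∧ 0 ≤ ab.2 ∧
    ∃ u v : ℝ → ℝ, IsEntireRadSol n p q f g ab.1 ab.2 u v}

/-- The set of radii `ρ > 0` on which a positive solution of the radial ODE system exists. -/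
def odeSolSet (n : ℕ) (p q f g : ℝ → ℝ) (a b : ℝ) : Set ℝ :=
  {ρ : ℝ | 0 < ρ ∧ ∃ u v : ℝ → ℝ, IsRadODESol n p q f g a b ρ u v}

end

/-- inner averaged integral -/
noncomputable def auxJ (n : ℕ) (w : ℝ → ℝ) (t : ℝ) : ℝ :=
  t ^ (1 - (n : ℤ)) * ∫ s in (0:ℝ)..t, s ^ ((n : ℤ) - 1) * w s

lemma aux_pow (m : ℕ) (s : ℝ) : s ^ (((m + 2 : ℕ) : ℤ) - 1) = s ^ (m + 1) := by
  have : (((m + 2 : ℕ) : ℤ) - 1) = ((m + 1 : ℕ) : ℤ) := by push_cast; ring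
  rw [this, zpow_natCast]

lemma aux_ipow (m : ℕ) (s : ℝ) : s ^ (1 - ((m + 2 : ℕ) : ℤ)) = (s ^ (m + 1))⁻¹ := by
  have : (1 - ((m + 2 : ℕ) : ℤ)) = -((m + 1 : ℕ) : ℤ) := by push_cast; ring
  rw [this, zpow_neg, zpow_natCast]

lemma auxJ_eq (m : ℕ) (w : ℝ → ℝ) (t : ℝ) :
    auxJ (m + 2) w t = (t ^ (m + 1))⁻¹ * ∫ s in (0:ℝ)..t, s ^ (m + 1) * w s := by
  unfold auxJ
  rw [aux_ipow]
  simp_rw [aux_pow]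

lemma auxJ_mono (m : ℕ) (w₁ w₂ : ℝ → ℝ) (h₁ : Continuous w₁) (h₂ : Continuous w₂) (t : ℝ)
    (ht : 0 ≤ t) (h : ∀ s ∈ Ioo 0 t, w₁ s ≤ w₂ s) : auxJ (m + 2) w₁ t ≤ auxJ (m + 2) w₂ t := by
  rw [auxJ_eq, auxJ_eq]
  apply mul_le_mul_of_nonneg_left _ (by positivity)
  apply intervalIntegral.integral_mono_on_of_le_Ioo ht
  · exact (by fun_prop : Continuous _).intervalIntegrable _ _
  · exact (by fun_prop : Continuous _).intervalIntegrable _ _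
  · intro s hs
    exact mul_le_mul_of_nonneg_left (h s hs) (pow_nonneg hs.1.le _)

lemma auxJ_abs_le (m : ℕ) (w : ℝ → ℝ) (t M : ℝ) (ht : 0 < t)
    (hM : ∀ s ∈ Icc 0 t, |w s| ≤ M) : |auxJ (m + 2) w t| ≤ M * t := by
  rw [auxJ_eq, abs_mul, abs_of_nonneg (by positivity : 0 ≤ (t ^ (m + 1))⁻¹)]
  have : ‖∫ s in (0:ℝ)..t, s ^ (m + 1) * w s‖ ≤ (t ^ (m + 1) * M) * |t - 0| := by
    apply intervalIntegral.norm_integral_le_of_norm_le_const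
    intro s hs
    rw [uIoc_of_le ht.le] at hs
    rw [norm_mul, Real.norm_eq_abs, Real.norm_eq_abs, abs_of_nonneg (pow_nonneg hs.1.le _)]
    exact mul_le_mul (pow_le_pow_left₀ hs.1.le hs.2 _) (hM s ⟨hs.1.le, hs.2⟩) (abs_nonneg _)
      (by positivity)
  rw [sub_zero, abs_of_pos ht, Real.norm_eq_abs] at this
  calc _ ≤ (t ^ (m + 1))⁻¹ * ((t ^ (m + 1) * M) * t) := by gcongr
    _ = M * t := by field_simp

lemma auxI_deriv (m : ℕ) (w : ℝ → ℝ) (hw : Continuous w) (t : ℝ) :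
    HasDerivAt (fun t => ∫ s in (0:ℝ)..t, s ^ (m + 1) * w s) (t ^ (m + 1) * w t) t := by
  have hc : Continuous (fun s => s ^ (m + 1) * w s) := by fun_prop
  exact intervalIntegral.integral_hasDerivAt_right (hc.intervalIntegrable _ _)
    (hc.stronglyMeasurableAtFilter _ _) hc.continuousAt

lemma auxJ_cont (m : ℕ) (w : ℝ → ℝ) (hw : Continuous w) (r : ℝ) :
    ContinuousOn (auxJ (m + 2) w) (Icc 0 r) := by
  intro t ht
  rcases eq_or_lt_of_le ht.1 with h0 | h0
  · subst h0
    obtain ⟨M, hM⟩ := isCompact_Icc.exists_bound_of_continuousOn (s := Icc 0 r)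
      (f := w) hw.continuousOn
    have hz : auxJ (m + 2) w 0 = 0 := by simp [auxJ_eq]
    unfold ContinuousWithinAt
    rw [hz]
    apply squeeze_zero_norm' (a := fun t => M * t)
    · filter_upwards [self_mem_nhdsWithin] with t ht
      rcases eq_or_lt_of_le ht.1 with h1 | h1
      · subst h1; simp [hz]
      · exact auxJ_abs_le m w t M h1 (fun s hs => hM s ⟨hs.1, hs.2.trans ht.2⟩)
    · have : ContinuousWithinAt (fun t : ℝ => M * t) (Icc 0 r) 0 := by fun_prop
      simpa [ContinuousWithinAt] using this
  · apply ContinuousAt.continuousWithinAt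
    have : auxJ (m + 2) w = fun t => (t ^ (m + 1))⁻¹ * ∫ s in (0:ℝ)..t, s ^ (m + 1) * w s := by
      ext t; exact auxJ_eq m w t
    rw [this]
    apply ContinuousAt.mul
    · exact ContinuousAt.inv₀ (by fun_prop) (by positivity)
    · exact (auxI_deriv m w hw t).continuousAt

lemma auxJ_int (m : ℕ) (w : ℝ → ℝ) (hw : Continuous w) (r : ℝ) (hr : 0 ≤ r) :
    IntervalIntegrable (auxJ (m + 2) w) volume 0 r :=
  (by rw [uIcc_of_le hr]; exact auxJ_cont m w hw r :
    ContinuousOn (auxJ (m + 2) w) (uIcc 0 r)).intervalIntegrable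

lemma auxJ_nonneg (m : ℕ) (w : ℝ → ℝ) (t : ℝ) (ht : 0 ≤ t)
    (h : ∀ s ∈ Icc 0 t, 0 ≤ w s) : 0 ≤ auxJ (m + 2) w t := by
  rw [auxJ_eq]
  apply mul_nonneg (by positivity)
  apply intervalIntegral.integral_nonneg ht
  intro s hs
  exact mul_nonneg (pow_nonneg hs.1 _) (h s hs)

lemma auxK_bound (m : ℕ) (hm : 1 ≤ m) (w : ℝ → ℝ) (hw : Continuous w) (r : ℝ) (hr : 0 ≤ r)
    (h : ∀ s ∈ Icc 0 r, 0 ≤ w s) :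
    (m : ℝ) * ∫ t in (0:ℝ)..r, auxJ (m + 2) w t ≤ ∫ s in (0:ℝ)..r, s * w s := by
  have hc : Continuous (fun s => s * w s) := by fun_prop
  have hd : ∀ t, HasDerivAt (fun t => ∫ s in (0:ℝ)..t, s * w s) (t * w t) t := fun t =>
    intervalIntegral.integral_hasDerivAt_right (hc.intervalIntegrable _ _)
      (hc.stronglyMeasurableAtFilter _ _) hc.continuousAt
  have key := intervalIntegral.integral_eq_sub_of_hasDerivAt_of_le hr
    (f := fun t => (∫ s in (0:ℝ)..t, s * w s) - t * auxJ (m + 2) w t)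
    (f' := fun t => (m : ℝ) * auxJ (m + 2) w t) ?_ ?_ ((auxJ_int m w hw r hr).const_mul _)
  · rw [intervalIntegral.integral_const_mul] at key
    rw [key]
    have := mul_nonneg hr (auxJ_nonneg m w r hr h)
    simp
    linarith
  · apply ContinuousOn.sub
    · exact fun t _ => (hd t).continuousAt.continuousWithinAt
    · exact continuousOn_id.mul (auxJ_cont m w hw r)
  · intro t ht
    have ht0 : t ≠ 0 := ht.1.ne'
    have h1 := (hasDerivAt_pow m t).inv (pow_ne_zero m ht0)
    have h2 := (hd t).sub (h1.mul (auxI_deriv m w hw t))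
    have h3 := h2.congr_of_eventuallyEq
      (f₁ := fun t => (∫ s in (0:ℝ)..t, s * w s) - t * auxJ (m + 2) w t) (by
        filter_upwards [lt_mem_nhds ht.1] with x hx
        simp only [auxJ_eq, Pi.sub_apply, Pi.mul_apply, Pi.inv_apply]
        have : x ≠ 0 := hx.ne'
        field_simp
        ring)
    convert h3 using 1
    rw [auxJ_eq]
    obtain ⟨k, rfl⟩ : ∃ k, m = k + 1 := ⟨m - 1, by omega⟩
    simp only [Pi.inv_apply, Nat.add_sub_cancel]
    field_simp
    ring

lemma auxJ_congr (n : ℕ) (w₁ w₂ : ℝ → ℝ) (t : ℝ) (ht : 0 ≤ t)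
    (h : ∀ s ∈ Icc 0 t, w₁ s = w₂ s) : auxJ n w₁ t = auxJ n w₂ t := by
  unfold auxJ
  congr 1
  apply intervalIntegral.integral_congr
  intro s hs
  rw [uIcc_of_le ht] at hs
  simp only [h s hs]

lemma auxK_congr (n : ℕ) (w₁ w₂ : ℝ → ℝ) (r : ℝ) (hr : 0 ≤ r)
    (h : ∀ s ∈ Icc 0 r, w₁ s = w₂ s) :
    ∫ t in (0:ℝ)..r, auxJ n w₁ t = ∫ t in (0:ℝ)..r, auxJ n w₂ t := by
  apply intervalIntegral.integral_congr
  intro t ht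
  rw [uIcc_of_le hr] at ht
  exact auxJ_congr n w₁ w₂ t ht.1 (fun s hs => h s ⟨hs.1, hs.2.trans ht.2⟩)

lemma aux_ext (w : ℝ → ℝ) (r : ℝ) (hr : 0 ≤ r) (hw : ContinuousOn w (Icc 0 r)) :
    ∃ w' : ℝ → ℝ, Continuous w' ∧ ∀ s ∈ Icc 0 r, w s = w' s :=
  ⟨IccExtend hr ((Icc 0 r).domRestrict w), (continuousOn_iff_continuous_domRestrict.1 hw).Icc_extend',
    fun s hs => by rw [IccExtend_of_mem _ _ hs]; rfl⟩

lemma auxK_mono (m : ℕ) (w₁ w₂ : ℝ → ℝ) (r : ℝ) (hr : 0 ≤ r) (h₁ : ContinuousOn w₁ (Icc 0 r))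
    (h₂ : ContinuousOn w₂ (Icc 0 r)) (h : ∀ s ∈ Ioo 0 r, w₁ s ≤ w₂ s) :
    ∫ t in (0:ℝ)..r, auxJ (m + 2) w₁ t ≤ ∫ t in (0:ℝ)..r, auxJ (m + 2) w₂ t := by
  obtain ⟨w₁', c₁, e₁⟩ := aux_ext w₁ r hr h₁
  obtain ⟨w₂', c₂, e₂⟩ := aux_ext w₂ r hr h₂
  rw [auxK_congr _ _ _ r hr e₁, auxK_congr _ _ _ r hr e₂]
  apply intervalIntegral.integral_mono_on_of_le_Ioo hr (auxJ_int m _ c₁ r hr)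
    (auxJ_int m _ c₂ r hr)
  intro t ht
  apply auxJ_mono m _ _ c₁ c₂ t ht.1.le
  intro s hs
  have hs' : s ∈ Ioo 0 r := ⟨hs.1, hs.2.trans ht.2⟩
  rw [← e₁ s (Ioo_subset_Icc_self hs'), ← e₂ s (Ioo_subset_Icc_self hs')]
  exact h s hs'

lemma auxK_const (n : ℕ) (C : ℝ) (w : ℝ → ℝ) (r : ℝ) :
    ∫ t in (0:ℝ)..r, auxJ n (fun s => C * w s) t = C * ∫ t in (0:ℝ)..r, auxJ n w t := by
  rw [← intervalIntegral.integral_const_mul]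
  congr 1
  ext t
  unfold auxJ
  have : (fun s : ℝ => s ^ ((n : ℤ) - 1) * (C * w s)) = fun s => C * (s ^ ((n : ℤ) - 1) * w s) := by
    ext s; ring
  rw [this, intervalIntegral.integral_const_mul]
  ring

lemma auxK_Lcoef (m : ℕ) (hm : 1 ≤ m) (w : ℝ → ℝ) (hw : ContinuousOn w (Ici 0))
    (h0 : ∀ s, 0 ≤ s → 0 ≤ w s) (hi : IntegrableOn (fun s : ℝ => s * w s) (Ioi 0))
    (r : ℝ) (hr : 0 ≤ r) :
    ∫ t in (0:ℝ)..r, auxJ (m + 2) w t ≤ Lcoef (m + 2) w := by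
  obtain ⟨w', c, e⟩ := aux_ext w r hr (hw.mono Icc_subset_Ici_self)
  have h1 := auxK_bound m hm w' c r hr (fun s hs => by rw [← e s hs]; exact h0 s hs.1)
  rw [← auxK_congr _ _ _ r hr e] at h1
  have h2 : ∫ s in (0:ℝ)..r, s * w' s = ∫ s in (0:ℝ)..r, s * w s := by
    apply intervalIntegral.integral_congr
    intro s hs
    rw [uIcc_of_le hr] at hs
    simp only [e s hs]
  rw [h2, intervalIntegral.integral_of_le (f := fun s => s * w s) hr] at h1
  have h3 : ∫ s in Ioc 0 r, s * w s ≤ ∫ s in Ioi (0:ℝ), s * w s := by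
    apply setIntegral_mono_set hi
    · filter_upwards [ae_restrict_mem measurableSet_Ioi] with s hs
      exact mul_nonneg (le_of_lt hs) (h0 s (le_of_lt hs))
    · exact (Ioc_subset_Ioi_self).eventuallyLE
  have hm' : (0:ℝ) < m := by exact_mod_cast hm
  unfold Lcoef
  have : (((m + 2 : ℕ) : ℝ) - 2) = m := by push_cast; ring
  rw [this, one_div, ← div_eq_inv_mul, le_div_iff₀ hm']
  linarith

lemma radK_eq (n : ℕ) (w h φ : ℝ → ℝ) (r : ℝ) :
    radK n w h φ r = ∫ t in (0:ℝ)..r, auxJ n (fun s => w s * h (φ s)) t := by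
  unfold radK auxJ
  simp only [mul_assoc]

lemma comparison_half (m : ℕ) (hm : 1 ≤ m) (f g p q : ℝ → ℝ)
    (fc : ContinuousOn f (Ici 0)) (gc : ContinuousOn g (Ici 0))
    (fm : MonotoneOn f (Ici 0)) (gm : MonotoneOn g (Ici 0)) (f0 : f 0 = 0) (g0 : g 0 = 0)
    (fp : ∀ s : ℝ, 0 < s → 0 < f s)
    (gs : ∀ l : ℝ, 0 ≤ l → ∀ t : ℝ, 0 ≤ t → g (l * t) ≤ g l * g t)
    (pc : ContinuousOn p (Ici 0)) (qc : ContinuousOn q (Ici 0))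
    (pp : ∀ s : ℝ, 0 ≤ s → 0 ≤ p s) (qp : ∀ s : ℝ, 0 ≤ s → 0 ≤ q s)
    (qi : IntegrableOn (fun s : ℝ => s * q s) (Ioi 0))
    (a b c R : ℝ) (ha : 0 < a) (hac : a < c) (hb : 0 < b)
    (u v z : ℝ → ℝ) (uc : ContinuousOn u (Icc 0 R)) (vc : ContinuousOn v (Icc 0 R))
    (up : ∀ r ∈ Icc (0:ℝ) R, 0 < u r) (vp : ∀ r ∈ Icc (0:ℝ) R, 0 < v r)
    (hu : ∀ r ∈ Icc (0:ℝ) R, u r = a + radK (m + 2) p g v r)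
    (hv : ∀ r ∈ Icc (0:ℝ) R, v r = b + radK (m + 2) q f u r)
    (um : MonotoneOn u (Icc 0 R))
    (zc : ContinuousOn z (Icc 0 R)) (zp : ∀ r ∈ Icc (0:ℝ) R, 0 < z r)
    (hz : ∀ r ∈ Icc (0:ℝ) R,
      z r = c + g (b / f a + Lcoef (m + 2) q) * radK (m + 2) p g (fun s => f (z s)) r) :
    ∀ r ∈ Icc (0:ℝ) R, u r < z r := by
  set A := b / f a + Lcoef (m + 2) q with hA
  have fnn : ∀ s, 0 ≤ s → 0 ≤ f s := fun s hs => f0 ▸ fm self_mem_Ici hs hs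
  have gnn : ∀ s, 0 ≤ s → 0 ≤ g s := fun s hs => g0 ▸ gm self_mem_Ici hs hs
  have hfa := fp a ha
  have hL : 0 ≤ Lcoef (m + 2) q := by
    have := auxK_Lcoef m hm q qc qp qi 0 le_rfl
    simpa using this
  have hA0 : 0 ≤ A := by positivity
  have sub : ∀ r ∈ Icc (0:ℝ) R, Icc 0 r ⊆ Icc 0 R := fun r hr => Icc_subset_Icc_right hr.2
  have pc' : ContinuousOn p (Icc 0 R) := pc.mono Icc_subset_Ici_self
  have qc' : ContinuousOn q (Icc 0 R) := qc.mono Icc_subset_Ici_self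
  have fu : ContinuousOn (fun s => f (u s)) (Icc 0 R) := fc.comp uc (fun s hs => (up s hs).le)
  have fz : ContinuousOn (fun s => f (z s)) (Icc 0 R) := fc.comp zc (fun s hs => (zp s hs).le)
  have gv : ContinuousOn (fun s => g (v s)) (Icc 0 R) := gc.comp vc (fun s hs => (vp s hs).le)
  have gfu : ContinuousOn (fun s => g (f (u s))) (Icc 0 R) :=
    gc.comp fu (fun s hs => (fp _ (up s hs)).le)
  have gfz : ContinuousOn (fun s => g (f (z s))) (Icc 0 R) :=
    gc.comp fz (fun s hs => (fp _ (zp s hs)).le)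
  have hu0 : ∀ r ∈ Icc (0:ℝ) R, a ≤ u r := by
    intro r hr
    have h0 : (0:ℝ) ∈ Icc 0 R := ⟨le_rfl, hr.1.trans hr.2⟩
    have h1 := hu 0 h0
    have h2 := um h0 hr hr.1
    simp [radK] at h1
    linarith
  have hvA : ∀ r ∈ Icc (0:ℝ) R, v r ≤ A * f (u r) := by
    intro r hr
    have h1 : radK (m + 2) q f u r ≤ f (u r) * Lcoef (m + 2) q := by
      rw [radK_eq]
      calc _ ≤ ∫ t in (0:ℝ)..r, auxJ (m + 2) (fun s => f (u r) * q s) t := by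
            apply auxK_mono m _ _ r hr.1 ((qc'.mul fu).mono (sub r hr))
              ((continuousOn_const.mul qc').mono (sub r hr))
            intro s hs
            have hsR : s ∈ Icc 0 R := sub r hr (Ioo_subset_Icc_self hs)
            have : f (u s) ≤ f (u r) := fm (up s hsR).le (up r hr).le (um hsR hr hs.2.le)
            have := mul_le_mul_of_nonneg_left this (qp s hs.1.le)
            simp only [Pi.mul_apply]
            linarith
        _ = f (u r) * ∫ t in (0:ℝ)..r, auxJ (m + 2) q t := auxK_const _ _ _ _
        _ ≤ _ := mul_le_mul_of_nonneg_left (auxK_Lcoef m hm q qc qp qi r hr.1)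
            (fnn _ (up r hr).le)
    have h2 : f a ≤ f (u r) := fm ha.le (up r hr).le (hu0 r hr)
    have h3 : b ≤ b / f a * f (u r) := by
      rw [div_mul_eq_mul_div, le_div_iff₀ hfa]
      exact mul_le_mul_of_nonneg_left h2 hb.le
    rw [hv r hr, hA]
    linarith
  by_contra hcon
  push Not at hcon
  obtain ⟨r₁, hr₁, hzu⟩ := hcon
  have hcl : IsClosed {r ∈ Icc (0:ℝ) R | z r ≤ u r} := isClosed_Icc.isClosed_le zc uc
  have hcp : IsCompact {r ∈ Icc (0:ℝ) R | z r ≤ u r} :=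
    isCompact_Icc.of_isClosed_subset hcl (sep_subset _ _)
  obtain ⟨r, ⟨hr, hzr⟩, hleast⟩ := hcp.exists_isLeast ⟨r₁, hr₁, hzu⟩
  have hlt : ∀ s ∈ Ioo 0 r, u s < z s := by
    intro s hs
    by_contra hn
    have := hleast ⟨sub r hr (Ioo_subset_Icc_self hs), not_lt.1 hn⟩
    linarith [hs.2]
  have hfin : radK (m + 2) p g v r ≤ g A * radK (m + 2) p g (fun s => f (z s)) r := by
    rw [radK_eq, radK_eq, ← auxK_const]
    apply auxK_mono m _ _ r hr.1 ((pc'.mul gv).mono (sub r hr))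
      ((continuousOn_const.mul (pc'.mul gfz)).mono (sub r hr))
    intro s hs
    have hsR : s ∈ Icc 0 R := sub r hr (Ioo_subset_Icc_self hs)
    have e0 := fnn _ (up s hsR).le
    have e1 : g (v s) ≤ g (A * f (u s)) := gm (vp s hsR).le (mul_nonneg hA0 e0) (hvA s hsR)
    have e2 := gs A hA0 _ e0
    have e3 : f (u s) ≤ f (z s) := fm (up s hsR).le (zp s hsR).le (hlt s hs).le
    have e4 : g (f (u s)) ≤ g (f (z s)) := gm e0 (fnn _ (zp s hsR).le) e3
    have e5 := mul_le_mul_of_nonneg_left e4 (gnn A hA0)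
    have e6 := mul_le_mul_of_nonneg_left (e1.trans (e2.trans e5)) (pp s hs.1.le)
    simp only [Pi.mul_apply]
    linarith
  have := hu r hr
  have := hz r hr
  linarith

/-- comparison with the auxiliary blow-up pair `(z₁, z₂)`. -/
theorem comparison_with_auxiliary_pair
    (n : ℕ) (hn : 3 ≤ n) (f g p q : ℝ → ℝ)
    (hF1 : hypF1 f g) (hF2 : hypF2 f g) (hPQ : hypPQ p q)
    (a b c d R : ℝ) (ha : 0 < a) (hac : a < c) (hb : 0 < b) (hbd : b < d)
    (hR : 0 ≤ R)
    (u v : ℝ → ℝ) (hsol : IsRadSolIcc n p q f g a b R u v)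
    (hu : MonotoneOn u (Icc 0 R)) (hv : MonotoneOn v (Icc 0 R))
    (z₁ z₂ : ℝ → ℝ)
    (hz₁C : ContDiffOn ℝ 2 z₁ (Icc 0 R)) (hz₂C : ContDiffOn ℝ 2 z₂ (Icc 0 R))
    (hz₁pos : ∀ r ∈ Icc (0:ℝ) R, 0 < z₁ r)
    (hz₂pos : ∀ r ∈ Icc (0:ℝ) R, 0 < z₂ r)
    (hz₁ : ∀ r ∈ Icc (0:ℝ) R,
      z₁ r = c + g (b / f a + Lcoef n q) * radK n p g (fun s => f (z₁ s)) r)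
    (hz₂ : ∀ r ∈ Icc (0:ℝ) R,
      z₂ r = d + f (a / g b + Lcoef n p) * radK n q f (fun s => g (z₂ s)) r) :
    ∀ r ∈ Icc (0:ℝ) R, u r < z₁ r ∧ v r < z₂ r := by
  obtain ⟨m, rfl⟩ : ∃ m, n = m + 2 := ⟨n - 2, by omega⟩
  have hm : 1 ≤ m := by omega
  obtain ⟨fc, gc, -, -, fm, gm, f0, g0, fp, gp⟩ := hF1
  obtain ⟨fs, gs⟩ := hF2
  obtain ⟨pc, qc, pp, qp, -, pi, qi, -⟩ := hPQ
  obtain ⟨uC, vC, pos, ue, ve⟩ := hsol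
  intro r hr
  exact ⟨comparison_half m hm f g p q fc gc fm gm f0 g0 fp gs pc qc pp qp qi a b c R ha hac hb
      u v z₁ uC.continuousOn vC.continuousOn (fun r hr => (pos r hr).1) (fun r hr => (pos r hr).2)
      ue ve hu hz₁C.continuousOn hz₁pos hz₁ r hr,
    comparison_half m hm g f q p gc fc gm fm g0 f0 gp fs qc pc qp pp pi b a d R hb hbd ha
      v u z₂ vC.continuousOn uC.continuousOn (fun r hr => (pos r hr).2) (fun r hr => (pos r hr).1)
      ve ue hv hz₂C.continuousOn hz₂pos hz₂ r hr⟩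
end

section
/- Let a, b > 0 and R < ∞, and let (u,v) be a positive radial C² solution of the system on [0,R) with central values (a,b). If u is bounded on [0,R), then v, u' and v' are also bounded on [0,R), and the solution extends to a positive radial C² solution on [0,R+δ) for some δ > 0. -/
open MeasureTheory Set Filter Topology

lemma radial_basic (m : ℕ) (hm : 1 ≤ m) (R : ℝ) (hR : 0 < R) (u h : ℝ → ℝ) (hu : ContDiffOn ℝ 2 u (Ico 0 R))
    (hh : ∀ r ∈ Ioo (0:ℝ) R, 0 ≤ h r)
    (ode : ∀ r ∈ Ioo (0:ℝ) R, deriv (deriv u) r + (m:ℝ) / r * deriv u r = h r) :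
    (∀ r ∈ Ioo (0:ℝ) R, HasDerivAt u (deriv u r) r) ∧
    (∀ r ∈ Ioo (0:ℝ) R, HasDerivAt (fun r => r ^ m * deriv u r) (r ^ m * h r) r) ∧
    (∀ r ∈ Ioo (0:ℝ) R, 0 ≤ deriv u r) ∧
    (∀ r ∈ Ico (0:ℝ) R, u 0 ≤ u r) ∧
    (∀ H : ℝ, (∀ r ∈ Ioo (0:ℝ) R, h r ≤ H) →
      (∀ r ∈ Ioo (0:ℝ) R, deriv u r ≤ H * R) ∧ ∀ r ∈ Ico (0:ℝ) R, u r ≤ u 0 + H * R * R) := by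
  have hnh : ∀ r ∈ Ioo (0:ℝ) R, Ico (0:ℝ) R ∈ 𝓝 r := fun r hr => Ico_mem_nhds hr.1 hr.2
  have hC2 : ∀ r ∈ Ioo (0:ℝ) R, ContDiffAt ℝ 2 u r := fun r hr =>
    (hu r ⟨hr.1.le, hr.2⟩).contDiffAt (hnh r hr)
  have h1 : ∀ r ∈ Ioo (0:ℝ) R, HasDerivAt u (deriv u r) r := fun r hr =>
    ((hC2 r hr).differentiableAt (by norm_num)).hasDerivAt
  have h2 : ∀ r ∈ Ioo (0:ℝ) R, HasDerivAt (deriv u) (deriv (deriv u) r) r := fun r hr => by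
    have : ContDiffAt ℝ 1 (deriv u) r := (hC2 r hr).derivWithin (m := 1) (by norm_num)
    exact (this.differentiableAt (by norm_num)).hasDerivAt
  have h3 : ∀ r ∈ Ioo (0:ℝ) R,
      HasDerivAt (fun r => r ^ m * deriv u r) (r ^ m * h r) r := fun r hr => by
    have := (hasDerivAt_pow m r).mul (h2 r hr)
    refine this.congr_deriv ?_
    rw [← ode r hr]
    have : r ≠ 0 := hr.1.ne'
    obtain ⟨k, rfl⟩ : ∃ k, m = k + 1 := ⟨m - 1, by omega⟩
    simp only [Nat.add_sub_cancel]
    field_simp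
    ring
  set D := derivWithin u (Ico 0 R) with hD
  have hDc : ContinuousOn D (Ico 0 R) :=
    hu.continuousOn_derivWithin (uniqueDiffOn_Ico 0 R) (by norm_num)
  have hDe : ∀ r ∈ Ioo (0:ℝ) R, D r = deriv u r := fun r hr =>
    derivWithin_of_mem_nhds (hnh r hr)
  have hGe : ∀ r ∈ Ioo (0:ℝ) R, HasDerivAt (fun r => r ^ m * D r) (r ^ m * h r) r := fun r hr => by
    refine (h3 r hr).congr_of_eventuallyEq ?_
    filter_upwards [Ioo_mem_nhds hr.1 hr.2] with x hx
    rw [hDe x hx]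
  have hGc : ContinuousOn (fun r => r ^ m * D r) (Ico 0 R) := (continuous_pow m).continuousOn.mul hDc
  have hm0 : m ≠ 0 := by omega
  have h4 : ∀ r ∈ Ioo (0:ℝ) R, 0 ≤ deriv u r := by
    have hmon : MonotoneOn (fun r => r ^ m * D r) (Ico 0 R) := by
      refine monotoneOn_of_deriv_nonneg (convex_Ico 0 R) hGc ?_ ?_
      · rw [interior_Ico]; exact fun r hr => (hGe r hr).differentiableAt.differentiableWithinAt
      · rw [interior_Ico]; intro r hr; rw [(hGe r hr).deriv]
        exact mul_nonneg (pow_nonneg hr.1.le _) (hh r hr)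
    intro r hr
    have := hmon (left_mem_Ico.2 hR) ⟨hr.1.le, hr.2⟩ hr.1.le
    simp only [zero_pow hm0, zero_mul, hDe r hr] at this
    exact nonneg_of_mul_nonneg_right this (pow_pos hr.1 _)
  refine ⟨h1, h3, h4, ?_, ?_⟩
  · have hmon : MonotoneOn u (Ico 0 R) := by
      refine monotoneOn_of_deriv_nonneg (convex_Ico 0 R) hu.continuousOn ?_ ?_
      · rw [interior_Ico]; exact fun r hr => (h1 r hr).differentiableAt.differentiableWithinAt
      · rw [interior_Ico]; exact h4
    exact fun r hr => hmon (left_mem_Ico.2 hR) hr hr.1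
  · intro H hH
    have hH0 : 0 ≤ H := (hh (R/2) ⟨by linarith, by linarith⟩).trans (hH (R/2) ⟨by linarith, by linarith⟩)
    have hb : ∀ r ∈ Ioo (0:ℝ) R, deriv u r ≤ H * R := by
      have hmon : AntitoneOn (fun r => r ^ m * D r - H * r ^ (m+1)) (Ico 0 R) := by
        have hd : ∀ r ∈ Ioo (0:ℝ) R, HasDerivAt (fun r => r ^ m * D r - H * r ^ (m+1))
          (r ^ m * h r - H * (((m+1 : ℕ):ℝ) * r ^ m)) r := fun r hr => by
            exact (hGe r hr).sub ((hasDerivAt_pow (m+1) r).const_mul H)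
        refine antitoneOn_of_deriv_nonpos (convex_Ico 0 R) (hGc.sub (by fun_prop)) ?_ ?_
        · rw [interior_Ico]; exact fun r hr => (hd r hr).differentiableAt.differentiableWithinAt
        · rw [interior_Ico]; intro r hr; rw [(hd r hr).deriv]
          have hp := pow_pos hr.1 m
          have h5 := mul_le_mul_of_nonneg_left (hH r hr) hp.le
          have h6 : 0 ≤ H * (m * r ^ m) := by positivity
          push_cast
          linarith
      intro r hr
      have := hmon (left_mem_Ico.2 hR) ⟨hr.1.le, hr.2⟩ hr.1.le
      simp only [zero_pow hm0, zero_mul, hDe r hr, zero_pow (Nat.succ_ne_zero m)] at this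
      have h7 : r ^ m * deriv u r ≤ r ^ m * (H * r) := by rw [pow_succ] at this; linarith
      exact (le_of_mul_le_mul_left h7 (pow_pos hr.1 _)).trans (mul_le_mul_of_nonneg_left hr.2.le hH0)
    refine ⟨hb, ?_⟩
    have hmon : AntitoneOn (fun r => u r - H * R * r) (Ico 0 R) := by
      have hd : ∀ r ∈ Ioo (0:ℝ) R, HasDerivAt (fun r => u r - H * R * r)
          (deriv u r - H * R) r := fun r hr => by
            exact ((h1 r hr).sub ((hasDerivAt_id r).const_mul (H * R))).congr_deriv (by ring)
      refine antitoneOn_of_deriv_nonpos (convex_Ico 0 R) (hu.continuousOn.sub (by fun_prop)) ?_ ?_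
      · rw [interior_Ico]; exact fun r hr => (hd r hr).differentiableAt.differentiableWithinAt
      · rw [interior_Ico]; intro r hr; rw [(hd r hr).deriv]
        linarith [hb r hr]
    intro r hr
    have := hmon (left_mem_Ico.2 hR) hr hr.1
    simp only at this
    have : H * R * r ≤ H * R * R := mul_le_mul_of_nonneg_left hr.2.le (by positivity)
    linarith

/-- double primitive operator -/
noncomputable def dop (c : ℝ) (k w : ℝ → ℝ) (x y : ℝ) (φ : ℝ → ℝ) (r : ℝ) : ℝ :=
  x + ∫ t in c..r, k t * (y + ∫ s in c..t, w s * φ s)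

lemma dop_int {w φ : ℝ → ℝ} {B : ℝ} (hw : Continuous w) (hφ : Measurable φ)
    (hB : ∀ s, |φ s| ≤ B) (a b : ℝ) : IntervalIntegrable (fun s => w s * φ s) volume a b := by
  refine IntervalIntegrable.mono_fun (f := fun s => B * w s) ((continuous_const.mul hw).intervalIntegrable a b)
    ((hw.measurable.mul hφ).aestronglyMeasurable) (Eventually.of_forall fun s => ?_)
  simp only [norm_mul, Real.norm_eq_abs]
  rw [mul_comm]
  exact mul_le_mul_of_nonneg_right ((hB s).trans (le_abs_self B)) (abs_nonneg _)

lemma dop_inner {c : ℝ} {k w φ : ℝ → ℝ} {y B : ℝ} (hk : Continuous k) (hw : Continuous w) (hφ : Measurable φ)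
    (hB : ∀ s, |φ s| ≤ B) : Continuous (fun t => k t * (y + ∫ s in c..t, w s * φ s)) :=
  hk.mul (continuous_const.add (intervalIntegral.continuous_primitive (dop_int hw hφ hB) c))

lemma dop_cont {c : ℝ} {k w φ : ℝ → ℝ} {x y B : ℝ} (hk : Continuous k) (hw : Continuous w) (hφ : Measurable φ)
    (hB : ∀ s, |φ s| ≤ B) : Continuous (dop c k w x y φ) :=
  continuous_const.add (intervalIntegral.continuous_primitive
    (fun a b => (dop_inner hk hw hφ hB).intervalIntegrable a b) c)

lemma dop_mono {c : ℝ} {k w φ ψ : ℝ → ℝ} {x y B : ℝ} (hk : Continuous k) (hw : Continuous w) 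
    (hk0 : ∀ s, c ≤ s → 0 ≤ k s) (hw0 : ∀ s, c ≤ s → 0 ≤ w s)
    (hφ : Measurable φ) (hψ : Measurable ψ)
    (hB : ∀ s, |φ s| ≤ B) (hB' : ∀ s, |ψ s| ≤ B) (r : ℝ) (hr : c ≤ r) (h : ∀ s, φ s ≤ ψ s) :
    dop c k w x y φ r ≤ dop c k w x y ψ r := by
  unfold dop
  gcongr
  refine intervalIntegral.integral_mono_on hr ((dop_inner hk hw hφ hB).intervalIntegrable _ _)
    ((dop_inner hk hw hψ hB').intervalIntegrable _ _) fun t ht => ?_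
  refine mul_le_mul_of_nonneg_left ?_ (hk0 t ht.1)
  gcongr
  refine intervalIntegral.integral_mono_on ht.1 (dop_int hw hφ hB _ _) (dop_int hw hψ hB' _ _) fun s hs => ?_
  exact mul_le_mul_of_nonneg_left (h s) (hw0 s hs.1)

lemma dop_congr {c : ℝ} {k w φ ψ : ℝ → ℝ} {x y : ℝ} (r : ℝ) (hr : c ≤ r) (h : ∀ s, c ≤ s → s ≤ r → φ s = ψ s) :
    dop c k w x y φ r = dop c k w x y ψ r := by
  unfold dop
  congr 1
  refine intervalIntegral.integral_congr fun t ht => ?_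
  rw [uIcc_of_le hr] at ht
  congr 2
  refine intervalIntegral.integral_congr fun s hs => ?_
  rw [uIcc_of_le ht.1] at hs
  show w s * φ s = w s * ψ s
  rw [h s hs.1 (hs.2.trans ht.2)]

lemma dop_tendsto {c : ℝ} {k w φ : ℝ → ℝ} {ψ : ℕ → ℝ → ℝ} {x y B : ℝ} (hk : Continuous k) (hw : Continuous w)
    (hψ : ∀ j, Measurable (ψ j)) (hB : ∀ j s, |ψ j s| ≤ B)
    (h : ∀ s, Tendsto (fun j => ψ j s) atTop (𝓝 (φ s))) (r : ℝ) (hr : c ≤ r) :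
    Tendsto (fun j => dop c k w x y (ψ j) r) atTop (𝓝 (dop c k w x y φ r)) := by
  have hB0 : 0 ≤ B := (abs_nonneg _).trans (hB 0 0)
  have hin : ∀ j s, ‖w s * ψ j s‖ ≤ |w s| * B := fun j s => by
    rw [norm_mul, Real.norm_eq_abs, Real.norm_eq_abs]
    exact mul_le_mul_of_nonneg_left (hB j s) (abs_nonneg _)
  have hwc : Continuous fun s => |w s| * B := (hw.abs.mul continuous_const)
  unfold dop
  refine tendsto_const_nhds.add ?_
  refine intervalIntegral.tendsto_integral_filter_of_dominated_convergence
    (fun t => |k t| * (|y| + ∫ s in c..t, |w s| * B))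
    (Eventually.of_forall fun j => (dop_inner hk hw (hψ j) (hB j)).aestronglyMeasurable) 
    (Eventually.of_forall fun j => Eventually.of_forall fun t ht => ?_) 
    ((hk.abs.mul (continuous_const.add (intervalIntegral.continuous_primitive 
      (fun a b => hwc.intervalIntegrable a b) c))).intervalIntegrable _ _)
    (Eventually.of_forall fun t ht => ?_)
  · rw [uIoc_of_le hr] at ht
    rw [norm_mul, Real.norm_eq_abs, Real.norm_eq_abs]
    refine mul_le_mul_of_nonneg_left ((abs_add_le _ _).trans ?_) (abs_nonneg _)
    gcongr
    exact intervalIntegral.norm_integral_le_of_norm_le ht.1.le 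
      (Eventually.of_forall fun s _ => hin j s) (hwc.intervalIntegrable _ _)
  · refine tendsto_const_nhds.mul (tendsto_const_nhds.add ?_)
    refine intervalIntegral.tendsto_integral_filter_of_dominated_convergence
      (fun s => |w s| * B)
      (Eventually.of_forall fun j => (hw.measurable.mul (hψ j)).aestronglyMeasurable) 
      (Eventually.of_forall fun j => Eventually.of_forall fun s _ => hin j s) 
      (hwc.intervalIntegrable _ _)
      (Eventually.of_forall fun s _ => tendsto_const_nhds.mul (h s))

lemma fixpt (c R : ℝ) (k w₁ w₂ F G U0 V0 : ℝ → ℝ) (x₁ y₁ x₂ y₂ B : ℝ)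
    (hk : Continuous k) (hw₁ : Continuous w₁) (hw₂ : Continuous w₂)
    (hk0 : ∀ s, c ≤ s → 0 ≤ k s) (hw₁0 : ∀ s, c ≤ s → 0 ≤ w₁ s) (hw₂0 : ∀ s, c ≤ s → 0 ≤ w₂ s)
    (hF : Continuous F) (hG : Continuous G) (hFm : Monotone F) (hGm : Monotone G)
    (hFB : ∀ s, |F s| ≤ B) (hGB : ∀ s, |G s| ≤ B)
    (hU0 : Measurable U0) (hV0 : Measurable V0)
    (hU : ∀ r, U0 r ≤ dop c k w₁ x₁ y₁ (G ∘ V0) (max r c))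
    (hV : ∀ r, V0 r ≤ dop c k w₂ x₂ y₂ (F ∘ U0) (max r c))
    (hUe : ∀ r ∈ Ico c R, dop c k w₁ x₁ y₁ (G ∘ V0) r = U0 r)
    (hVe : ∀ r ∈ Ico c R, dop c k w₂ x₂ y₂ (F ∘ U0) r = V0 r) :
    ∃ U V : ℝ → ℝ, Continuous U ∧ Continuous V ∧
      (∀ r, c ≤ r → U r = dop c k w₁ x₁ y₁ (G ∘ V) r) ∧
      (∀ r, c ≤ r → V r = dop c k w₂ x₂ y₂ (F ∘ U) r) ∧
      (∀ r, U0 r ≤ U r) ∧ (∀ r, V0 r ≤ V r) ∧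
      (∀ r ∈ Ico c R, U r = U0 r) ∧ (∀ r ∈ Ico c R, V r = V0 r) := by
  obtain ⟨A, C, hA0, hC0, hA, hC⟩ : ∃ A C : ℕ → ℝ → ℝ, A 0 = U0 ∧ C 0 = V0 ∧
      (∀ j, A (j+1) = fun r => dop c k w₁ x₁ y₁ (G ∘ C j) (max r c)) ∧
      (∀ j, C (j+1) = fun r => dop c k w₂ x₂ y₂ (F ∘ A j) (max r c)) := by
    let step : (ℝ → ℝ) × (ℝ → ℝ) → (ℝ → ℝ) × (ℝ → ℝ) := fun P =>
      (fun r => dop c k w₁ x₁ y₁ (G ∘ P.2) (max r c), fun r => dop c k w₂ x₂ y₂ (F ∘ P.1) (max r c))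
    refine ⟨fun j => (step^[j] (U0, V0)).1, fun j => (step^[j] (U0, V0)).2, rfl, rfl, fun j => ?_, fun j => ?_⟩
    · simp only [Function.iterate_succ_apply']
      rfl
    · simp only [Function.iterate_succ_apply']
      rfl
  have hmc : Continuous fun r : ℝ => max r c := by fun_prop
  have hmeas : ∀ j, Measurable (A j) ∧ Measurable (C j) := by
    intro j
    induction j with
    | zero => rw [hA0, hC0]; exact ⟨hU0, hV0⟩
    | succ j ih =>
      rw [hA, hC]
      exact ⟨((dop_cont hk hw₁ (hG.measurable.comp ih.2) (fun s => hGB _)).comp hmc).measurable,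
        ((dop_cont hk hw₂ (hF.measurable.comp ih.1) (fun s => hFB _)).comp hmc).measurable⟩
  have hstep : ∀ j, (∀ r, A j r ≤ A (j+1) r) ∧ (∀ r, C j r ≤ C (j+1) r) := by
    intro j
    induction j with
    | zero => rw [hA, hC, hA0, hC0]; exact ⟨hU, hV⟩
    | succ j ih =>
      rw [hA (j+1), hC (j+1)]
      constructor
      · intro r
        rw [hA j]
        exact dop_mono hk hw₁ hk0 hw₁0 (hG.measurable.comp (hmeas j).2) 
          (hG.measurable.comp (hmeas (j+1)).2) (fun s => hGB _) (fun s => hGB _) _ (le_max_right _ _)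
          (fun s => hGm (ih.2 s))
      · intro r
        rw [hC j]
        exact dop_mono hk hw₂ hk0 hw₂0 (hF.measurable.comp (hmeas j).1) 
          (hF.measurable.comp (hmeas (j+1)).1) (fun s => hFB _) (fun s => hFB _) _ (le_max_right _ _)
          (fun s => hFm (ih.1 s))
  have hm1 : ∀ r, Monotone fun j => A j r := fun r => monotone_nat_of_le_succ fun j => (hstep j).1 r
  have hm2 : ∀ r, Monotone fun j => C j r := fun r => monotone_nat_of_le_succ fun j => (hstep j).2 r
  have hbd1 : ∀ r, BddAbove (range fun j => A j r) := fun r => by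
    refine ⟨dop c k w₁ x₁ y₁ (fun _ => B) (max r c), ?_⟩
    rintro _ ⟨j, rfl⟩
    refine (hm1 r (Nat.le_succ j)).trans ?_
    simp only [Nat.succ_eq_add_one, hA]
    exact dop_mono (B := |B|) hk hw₁ hk0 hw₁0 (hG.measurable.comp (hmeas j).2) measurable_const
      (fun s => (hGB _).trans (le_abs_self _)) (fun s => le_rfl) _ (le_max_right _ _)
      (fun s => (le_abs_self _).trans (hGB _))
  have hbd2 : ∀ r, BddAbove (range fun j => C j r) := fun r => by
    refine ⟨dop c k w₂ x₂ y₂ (fun _ => B) (max r c), ?_⟩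
    rintro _ ⟨j, rfl⟩
    refine (hm2 r (Nat.le_succ j)).trans ?_
    simp only [Nat.succ_eq_add_one, hC]
    exact dop_mono (B := |B|) hk hw₂ hk0 hw₂0 (hF.measurable.comp (hmeas j).1) measurable_const
      (fun s => (hFB _).trans (le_abs_self _)) (fun s => le_rfl) _ (le_max_right _ _)
      (fun s => (le_abs_self _).trans (hFB _))
  let U : ℝ → ℝ := fun r => ⨆ j, A j r
  let V : ℝ → ℝ := fun r => ⨆ j, C j r
  have ht1 : ∀ r, Tendsto (fun j => A j r) atTop (𝓝 (U r)) := fun r => tendsto_atTop_ciSup (hm1 r) (hbd1 r)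
  have ht2 : ∀ r, Tendsto (fun j => C j r) atTop (𝓝 (V r)) := fun r => tendsto_atTop_ciSup (hm2 r) (hbd2 r)
  have hUM : Measurable U := measurable_of_tendsto_metrizable (fun j => (hmeas j).1) (tendsto_pi_nhds.2 ht1)
  have hVM : Measurable V := measurable_of_tendsto_metrizable (fun j => (hmeas j).2) (tendsto_pi_nhds.2 ht2)
  have hfU : ∀ r, U r = dop c k w₁ x₁ y₁ (G ∘ V) (max r c) := fun r => by
    refine tendsto_nhds_unique ((tendsto_add_atTop_iff_nat 1).2 (ht1 r)) ?_
    simp only [hA]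
    exact dop_tendsto (ψ := fun j => G ∘ C j) hk hw₁ (fun j => hG.measurable.comp (hmeas j).2) (fun j s => hGB _) 
      (fun s => (hG.tendsto _).comp (ht2 s)) _ (le_max_right _ _)
  have hfV : ∀ r, V r = dop c k w₂ x₂ y₂ (F ∘ U) (max r c) := fun r => by
    refine tendsto_nhds_unique ((tendsto_add_atTop_iff_nat 1).2 (ht2 r)) ?_
    simp only [hC]
    exact dop_tendsto (ψ := fun j => F ∘ A j) hk hw₂ (fun j => hF.measurable.comp (hmeas j).1) (fun j s => hFB _) 
      (fun s => (hF.tendsto _).comp (ht1 s)) _ (le_max_right _ _)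
  have heq : ∀ j, (∀ r ∈ Ico c R, A j r = U0 r) ∧ (∀ r ∈ Ico c R, C j r = V0 r) := by
    intro j
    induction j with
    | zero => rw [hA0, hC0]; exact ⟨fun r _ => rfl, fun r _ => rfl⟩
    | succ j ih =>
      rw [hA, hC]
      constructor
      · intro r hr
        rw [← hUe r hr]
        simp only [max_eq_left hr.1]
        exact dop_congr r hr.1 fun s h1 h2 => by simp [ih.2 s ⟨h1, h2.trans_lt hr.2⟩]
      · intro r hr
        rw [← hVe r hr]
        simp only [max_eq_left hr.1]
        exact dop_congr r hr.1 fun s h1 h2 => by simp [ih.1 s ⟨h1, h2.trans_lt hr.2⟩]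
  refine ⟨U, V, ?_, ?_, ?_, ?_, fun r => hA0 ▸ le_ciSup (hbd1 r) 0, fun r => hC0 ▸ le_ciSup (hbd2 r) 0, ?_, ?_⟩
  · rw [funext hfU]
    exact (dop_cont hk hw₁ (hG.measurable.comp hVM) (fun s => hGB _)).comp hmc
  · rw [funext hfV]
    exact (dop_cont hk hw₂ (hF.measurable.comp hUM) (fun s => hFB _)).comp hmc
  · intro r hr; rw [hfU, max_eq_left hr]
  · intro r hr; rw [hfV, max_eq_left hr]
  · intro r hr; simp [U, fun j => (heq j).1 r hr]
  · intro r hr; simp [V, fun j => (heq j).2 r hr]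

lemma dop_rep (m : ℕ) (R c : ℝ) (hc : c ∈ Ioo 0 R) (u h w φ : ℝ → ℝ)
    (h1 : ∀ r ∈ Ioo (0:ℝ) R, HasDerivAt u (deriv u r) r)
    (h2 : ∀ r ∈ Ioo (0:ℝ) R, HasDerivAt (fun r => r ^ m * deriv u r) (r ^ m * h r) r)
    (hh : ContinuousOn h (Ioo 0 R)) (hw : ∀ s ∈ Ico c R, w s * φ s = s ^ m * h s)
    (r : ℝ) (hr : r ∈ Ico c R) :
    dop c (fun t => ((max t c) ^ m)⁻¹) w (u c) (c ^ m * deriv u c) φ r = u r := by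
  have hsub : ∀ t ∈ Ico c R, uIcc c t ⊆ Ioo 0 R := fun t ht => by
    rw [uIcc_of_le ht.1]; exact fun s hs => ⟨hc.1.trans_le hs.1, hs.2.trans_lt ht.2⟩
  have e1 : ∀ t ∈ Ico c R, c ^ m * deriv u c + ∫ s in c..t, w s * φ s = t ^ m * deriv u t := fun t ht => by
    have : ∫ s in c..t, w s * φ s = ∫ s in c..t, s ^ m * h s :=
      intervalIntegral.integral_congr fun s hs => by
        rw [uIcc_of_le ht.1] at hs
        exact hw s ⟨hs.1, hs.2.trans_lt ht.2⟩
    rw [this, intervalIntegral.integral_eq_sub_of_hasDerivAt (fun s hs => h2 s (hsub t ht hs))]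
    · ring
    · exact (((continuous_pow m).continuousOn.mul hh).mono (hsub t ht)).intervalIntegrable
  have hdc : ContinuousOn (deriv u) (Ioo 0 R) := by
    have : ContinuousOn (fun r => (r ^ m)⁻¹ * (r ^ m * deriv u r)) (Ioo 0 R) := by
      refine ContinuousOn.mul (ContinuousOn.inv₀ (by fun_prop) fun s hs => (pow_pos hs.1 m).ne') ?_
      exact fun s hs => (h2 s hs).continuousAt.continuousWithinAt
    refine this.congr fun s hs => ?_
    have := (pow_pos hs.1 m).ne'
    field_simp
  unfold dop
  have e2 : ∫ t in c..r, ((max t c) ^ m)⁻¹ * (c ^ m * deriv u c + ∫ s in c..t, w s * φ s)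
      = ∫ t in c..r, deriv u t := intervalIntegral.integral_congr fun t ht => by
    rw [uIcc_of_le hr.1] at ht
    have htt : t ∈ Ico c R := ⟨ht.1, ht.2.trans_lt hr.2⟩
    have := (pow_pos (hc.1.trans_le ht.1) m).ne'
    rw [e1 t htt, max_eq_left ht.1]
    field_simp
  rw [e2, intervalIntegral.integral_eq_sub_of_hasDerivAt (fun s hs => h1 s (hsub r hr hs))]
  · ring
  · exact (hdc.mono (hsub r hr)).intervalIntegrable

lemma dop_ge {c : ℝ} {k w φ : ℝ → ℝ} {x y : ℝ}
    (hk0 : ∀ s, c ≤ s → 0 ≤ k s) (hw0 : ∀ s, c ≤ s → 0 ≤ w s) (hφ : ∀ s, 0 ≤ φ s) (hy : 0 ≤ y)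
    (r : ℝ) (hr : c ≤ r) : x ≤ dop c k w x y φ r := by
  unfold dop
  have : 0 ≤ ∫ t in c..r, k t * (y + ∫ s in c..t, w s * φ s) := by
    refine intervalIntegral.integral_nonneg hr fun t ht => mul_nonneg (hk0 t ht.1) (add_nonneg hy ?_)
    exact intervalIntegral.integral_nonneg ht.1 fun s hs => mul_nonneg (hw0 s hs.1) (hφ s)
  linarith

lemma dop_smooth (m : ℕ) (hm : 1 ≤ m) (c x y : ℝ) (hc : 0 < c) (U w φ : ℝ → ℝ) (hw : Continuous w) (hφ : Continuous φ)
    (hU : ∀ r, c ≤ r → U r = dop c (fun t => ((max t c) ^ m)⁻¹) w x y φ r) (r : ℝ) (hr : c < r) :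
    ContDiffAt ℝ 2 U r ∧ deriv (deriv U) r + m / r * deriv U r = w r * φ r / r ^ m := by
  have hkc : Continuous (fun t : ℝ => ((max t c) ^ m)⁻¹) :=
    Continuous.inv₀ (by fun_prop) fun t => (pow_pos (hc.trans_le (le_max_right _ _)) m).ne'
  have hwφ : Continuous fun s => w s * φ s := hw.mul hφ
  set I : ℝ → ℝ := fun t => ∫ s in c..t, w s * φ s with hI
  have hId : ∀ t, HasDerivAt I (w t * φ t) t := fun t =>
    intervalIntegral.integral_hasDerivAt_right (hwφ.intervalIntegrable _ _) 
      hwφ.stronglyMeasurable.stronglyMeasurableAtFilter hwφ.continuousAt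
  have hIc : Continuous I := continuous_iff_continuousAt.2 fun t => (hId t).continuousAt
  have hkI : Continuous fun t => ((max t c) ^ m)⁻¹ * (y + I t) := hkc.mul (continuous_const.add hIc)
  have hUd : ∀ t ∈ Ioi c, HasDerivAt U ((t ^ m)⁻¹ * (y + I t)) t := fun t ht => by
    have h0 : HasDerivAt (fun r => x + ∫ t in c..r, ((max t c) ^ m)⁻¹ * (y + I t)) 
        (((max t c) ^ m)⁻¹ * (y + I t)) t := 
      (intervalIntegral.integral_hasDerivAt_right (hkI.intervalIntegrable _ _) 
      hkI.stronglyMeasurable.stronglyMeasurableAtFilter hkI.continuousAt).const_add x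
    rw [max_eq_left (le_of_lt ht)] at h0
    refine h0.congr_of_eventuallyEq ?_
    filter_upwards [Ioi_mem_nhds ht] with s hs
    exact hU s (le_of_lt hs)
  have hIC : ContDiff ℝ 1 I := by
    rw [contDiff_one_iff_deriv]
    refine ⟨fun t => (hId t).differentiableAt, ?_⟩
    rw [show deriv I = fun t => w t * φ t from funext fun t => (hId t).deriv]
    exact hwφ
  have hde : ∀ t ∈ Ioi c, deriv U t = (t ^ m)⁻¹ * (y + I t) := fun t ht => (hUd t ht).deriv
  have hev : deriv U =ᶠ[𝓝 r] fun t => (t ^ m)⁻¹ * (y + I t) := by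
    filter_upwards [Ioi_mem_nhds hr] with s hs using hde s hs
  have hr0 : r ≠ 0 := (hc.trans hr).ne'
  constructor
  · have : ContDiffOn ℝ (1+1) U (Ioi c) := by
      rw [contDiffOn_succ_iff_deriv_of_isOpen isOpen_Ioi]
      refine ⟨fun t ht => (hUd t ht).differentiableAt.differentiableWithinAt, by simp, ?_⟩
      refine ContDiffOn.congr ?_ hde
      refine ContDiffOn.mul (ContDiffOn.inv (by fun_prop) fun t ht => ?_) (contDiffOn_const.add hIC.contDiffOn)
      exact (pow_pos (hc.trans ht) m).ne'
    have h2 := this.contDiffAt (Ioi_mem_nhds hr)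
    rwa [one_add_one_eq_two] at h2
  · rw [hev.deriv_eq, hde r hr]
    have h3 : HasDerivAt (fun t => (t ^ m)⁻¹ * (y + I t)) _ r := 
      ((hasDerivAt_pow m r).fun_inv (pow_ne_zero m hr0)).mul ((hId r).const_add y)
    rw [h3.deriv]
    obtain ⟨k, rfl⟩ : ∃ k, m = k + 1 := ⟨m - 1, by omega⟩
    simp only [Nat.add_sub_cancel]
    field_simp
    ring

lemma glue (m : ℕ) (R c ρ : ℝ) (hc : c ∈ Ioo 0 R) (hρ : R < ρ) (u h U Uf : ℝ → ℝ)
    (hu : ContDiffOn ℝ 2 u (Ico 0 R))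
    (ode : ∀ r ∈ Ioo (0:ℝ) R, deriv (deriv u) r + (m:ℝ) / r * deriv u r = h r)
    (hd0 : deriv u 0 = 0)
    (hU : ∀ r ∈ Ioo c ρ, ContDiffAt ℝ 2 U r ∧ deriv (deriv U) r + m / r * deriv U r = h r)
    (h1 : ∀ r, r < R → Uf r = u r) (h2 : ∀ r, c < r → Uf r = U r) :
    ContDiffOn ℝ 2 Uf (Ico 0 ρ) ∧ deriv Uf 0 = 0 ∧ 
    ∀ r ∈ Ioo (0:ℝ) ρ, deriv (deriv Uf) r + (m:ℝ) / r * deriv Uf r = h r := by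
  have e1 : ∀ r, r < R → Uf =ᶠ[𝓝 r] u := fun r hr => by
    filter_upwards [Iio_mem_nhds hr] with s hs using h1 s hs
  have e2 : ∀ r, c < r → Uf =ᶠ[𝓝 r] U := fun r hr => by
    filter_upwards [Ioi_mem_nhds hr] with s hs using h2 s hs
  refine ⟨fun r hr => ?_, ?_, fun r hr => ?_⟩
  · rcases lt_or_ge r R with h | h
    · have h3 : ContDiffWithinAt ℝ 2 u (Ico 0 ρ) r := by
        refine (hu r ⟨hr.1, h⟩).mono_of_mem_nhdsWithin ?_
        filter_upwards [self_mem_nhdsWithin, mem_nhdsWithin_of_mem_nhds (Iio_mem_nhds h)] with s hs hs'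
        exact ⟨hs.1, hs'⟩
      exact h3.congr_of_eventuallyEq ((e1 r h).filter_mono nhdsWithin_le_nhds) (h1 r h)
    · have hcr : c < r := hc.2.trans_le h
      exact ((hU r ⟨hcr, hr.2⟩).1.congr_of_eventuallyEq (e2 r hcr)).contDiffWithinAt
  · rw [(e1 0 (hc.1.trans hc.2)).deriv_eq, hd0]
  · rcases lt_or_ge r R with h | h
    · rw [(e1 r h).deriv.deriv_eq, (e1 r h).deriv_eq]
      exact ode r ⟨hr.1, h⟩
    · have hcr : c < r := hc.2.trans_le h
      rw [(e2 r hcr).deriv.deriv_eq, (e2 r hcr).deriv_eq]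
      exact (hU r ⟨hcr, hr.2⟩).2

lemma clip_props (f : ℝ → ℝ) (K : ℝ) (hK : 0 ≤ K) (hf : ContinuousOn f (Ici 0)) (hm : MonotoneOn f (Ici 0))
    (h0 : f 0 = 0) :
    ∃ F : ℝ → ℝ, Continuous F ∧ Monotone F ∧ (∀ s, 0 ≤ F s) ∧ (∀ s, F s ≤ f K) ∧ 
      ∀ s, 0 ≤ s → s ≤ K → F s = f s := by
  have hp : ∀ s : ℝ, (0:ℝ) ≤ min (max s 0) K := fun s => le_min (le_max_right _ _) hK
  have hm' : Monotone fun s => f (min (max s 0) K) := fun s t hst => hm (hp s) (hp t) (by gcongr)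
  refine ⟨fun s => f (min (max s 0) K), ?_, hm', fun s => ?_, fun s => ?_, ?_⟩
  · exact hf.comp_continuous (by fun_prop) hp
  · exact h0.symm.le.trans (hm (mem_Ici.2 le_rfl) (hp s) (hp s))
  · exact hm (hp s) hK (min_le_right _ _)
  · intro s h1 h2
    simp [max_eq_left h1, min_eq_left h2]

/-- boundedness of one component propagates, and the solution
extends beyond a finite radius. -/
theorem extension_beyond_finite_radius
    (n : ℕ) (hn : 3 ≤ n) (f g p q : ℝ → ℝ)
    (hF1 : hypF1 f g)
    (hp : ContinuousOn p (Ici 0)) (hq : ContinuousOn q (Ici 0))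
    (hp0 : ∀ s : ℝ, 0 ≤ s → 0 ≤ p s) (hq0 : ∀ s : ℝ, 0 ≤ s → 0 ≤ q s)
    (a b R : ℝ) (ha : 0 < a) (hb : 0 < b) (hR : 0 < R)
    (u v : ℝ → ℝ) (hsol : IsRadODESol n p q f g a b R u v)
    (hub : ∃ M : ℝ, ∀ r ∈ Ico (0:ℝ) R, u r ≤ M) :
    (∃ M : ℝ, ∀ r ∈ Ico (0:ℝ) R, v r ≤ M) ∧
    (∃ M : ℝ, ∀ r ∈ Ico (0:ℝ) R, |deriv u r| ≤ M) ∧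
    (∃ M : ℝ, ∀ r ∈ Ico (0:ℝ) R, |deriv v r| ≤ M) ∧
    ∃ δ : ℝ, 0 < δ ∧ ∃ U V : ℝ → ℝ,
      IsRadODESol n p q f g a b (R + δ) U V ∧
      EqOn U u (Ico 0 R) ∧ EqOn V v (Ico 0 R) := by
  obtain ⟨m, rfl⟩ : ∃ m, n = m + 1 := ⟨n - 1, by omega⟩
  have hm : 1 ≤ m := by omega
  obtain ⟨hfc, hgc, -, -, hfm, hgm, hf0, hg0, hfp, hgp⟩ := hF1
  obtain ⟨hu, hv, hpos, hua, hvb, hdu, hdv, hode⟩ := hsol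
  obtain ⟨M, hM⟩ := hub
  have hcast : (((m + 1 : ℕ) : ℝ) - 1) = m := by push_cast; ring
  simp only [hcast] at hode
  have hIoo : ∀ r ∈ Ioo (0:ℝ) R, r ∈ Ico (0:ℝ) R := fun r hr => ⟨hr.1.le, hr.2⟩
  have hgv0 : ∀ r ∈ Ioo (0:ℝ) R, 0 ≤ p r * g (v r) := fun r hr =>
    mul_nonneg (hp0 r hr.1.le) (hgp _ (hpos r (hIoo r hr)).2).le
  have hfu0 : ∀ r ∈ Ioo (0:ℝ) R, 0 ≤ q r * f (u r) := fun r hr =>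
    mul_nonneg (hq0 r hr.1.le) (hfp _ (hpos r (hIoo r hr)).1).le
  obtain ⟨u1, u2, u3, u4, u5⟩ := radial_basic m hm R hR u (fun r => p r * g (v r)) hu hgv0
    (fun r hr => (hode r hr).1)
  obtain ⟨v1, v2, v3, v4, v5⟩ := radial_basic m hm R hR v (fun r => q r * f (u r)) hv hfu0
    (fun r hr => (hode r hr).2)
  -- bounds for the weights
  have hbdw : ∀ w : ℝ → ℝ, ContinuousOn w (Ici 0) → ∃ C : ℝ, ∀ s ∈ Icc (0:ℝ) R, w s ≤ C := fun w hw => by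
    obtain ⟨C, hC⟩ := (isCompact_Icc (a := (0:ℝ)) (b := R)).bddAbove_image (hw.mono Icc_subset_Ici_self)
    exact ⟨C, fun s hs => hC (mem_image_of_mem w hs)⟩
  obtain ⟨P, hP⟩ := hbdw p hp
  obtain ⟨Q, hQ⟩ := hbdw q hq
  have hM0 : 0 < M := (hpos 0 (left_mem_Ico.2 hR)).1.trans_le (hM 0 (left_mem_Ico.2 hR))
  obtain ⟨v6, v7⟩ := v5 (Q * f M) fun r hr => by
    have h1 := hQ r ⟨hr.1.le, hr.2.le⟩
    have h2 := hpos r (hIoo r hr)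
    exact mul_le_mul h1 (hfm h2.1.le hM0.le (hM r (hIoo r hr))) (hfp _ h2.1).le ((hq0 r hr.1.le).trans h1)
  obtain ⟨N, hN⟩ : ∃ N, ∀ r ∈ Ico (0:ℝ) R, v r ≤ N := ⟨_, v7⟩
  have hN0 : 0 < N := (hpos 0 (left_mem_Ico.2 hR)).2.trans_le (hN 0 (left_mem_Ico.2 hR))
  obtain ⟨u6, u7⟩ := u5 (P * g N) fun r hr => by
    have h1 := hP r ⟨hr.1.le, hr.2.le⟩
    have h2 := hpos r (hIoo r hr)
    exact mul_le_mul h1 (hgm h2.2.le hN0.le (hN r (hIoo r hr))) (hgp _ h2.2).le ((hp0 r hr.1.le).trans h1)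
  have habs : ∀ (w : ℝ → ℝ) (C : ℝ), deriv w 0 = 0 → (∀ r ∈ Ioo (0:ℝ) R, 0 ≤ deriv w r) → 
      (∀ r ∈ Ioo (0:ℝ) R, deriv w r ≤ C) → ∃ M : ℝ, ∀ r ∈ Ico (0:ℝ) R, |deriv w r| ≤ M := by
    intro w C h0 h1 h2
    refine ⟨max C 0, fun r hr => ?_⟩
    rcases hr.1.eq_or_lt with h | h
    · rw [← h, h0]; simp
    · rw [abs_of_nonneg (h1 r ⟨h, hr.2⟩)]
      exact (h2 r ⟨h, hr.2⟩).trans (le_max_left _ _)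
  refine ⟨⟨N, hN⟩, habs u _ hdu u3 u6, habs v _ hdv v3 v6, ?_⟩
  -- extension
  set K := max M N + 1 with hK
  have hMK : M < K := by have := le_max_left M N; linarith
  have hNK : N < K := by have := le_max_right M N; linarith
  have hK0 : 0 ≤ K := by linarith
  obtain ⟨F, F1, F2, F3, F4, F5⟩ := clip_props f K hK0 hfc hfm hf0
  obtain ⟨G, G1, G2, G3, G4, G5⟩ := clip_props g K hK0 hgc hgm hg0
  set c := R / 2 with hcdef
  have hc : c ∈ Ioo 0 R := ⟨by positivity, by rw [hcdef]; linarith⟩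
  have hcI : ∀ r ∈ Ico c R, r ∈ Ioo (0:ℝ) R := fun r hr => ⟨hc.1.trans_le hr.1, hr.2⟩
  have hkc : Continuous (fun t : ℝ => ((max t c) ^ m)⁻¹) :=
    Continuous.inv₀ (by fun_prop) fun t => (pow_pos (hc.1.trans_le (le_max_right _ _)) m).ne'
  have hk0 : ∀ t, c ≤ t → 0 ≤ ((max t c) ^ m)⁻¹ := fun t _ =>
    inv_nonneg.2 (pow_nonneg (hc.1.le.trans (le_max_right _ _)) m)
  have hwt : ∀ p : ℝ → ℝ, ContinuousOn p (Ici 0) → (∀ s, 0 ≤ s → 0 ≤ p s) → ∃ w : ℝ → ℝ, Continuous w ∧ 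
      (∀ s, c ≤ s → 0 ≤ w s) ∧ ∀ s, c ≤ s → w s = s ^ m * p s := fun p hp hp0 => by
    refine ⟨fun s => s ^ m * p (max s 0), (continuous_pow m).mul 
      (hp.comp_continuous (by fun_prop) fun s => mem_Ici.2 (le_max_right _ _)), fun s hs => ?_, fun s hs => ?_⟩
    · exact mul_nonneg (pow_nonneg (hc.1.le.trans hs) m) (hp0 _ (le_max_right _ _))
    · simp only [max_eq_left (hc.1.le.trans hs)]
  obtain ⟨w₁, w₁c, w₁0, w₁e⟩ := hwt p hp hp0
  obtain ⟨w₂, w₂c, w₂0, w₂e⟩ := hwt q hq hq0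
  let ext : (ℝ → ℝ) → ℝ → ℝ → ℝ := fun u a r => if r ∈ Ico c R then u r else a
  have hext : ∀ (u : ℝ → ℝ) (a : ℝ), ContinuousOn u (Ico 0 R) → Measurable (ext u a) := fun u a hu => by
    have : ContinuousOn u (Ico c R) := hu.mono fun r hr => hIoo r (hcI r hr)
    exact this.measurable_piecewise continuousOn_const measurableSet_Ico
  have hextE : ∀ (u : ℝ → ℝ) (a : ℝ), ∀ r ∈ Ico c R, ext u a r = u r := fun u a r hr => if_pos hr
  have hrepU : ∀ r ∈ Ico c R, dop c (fun t => ((max t c) ^ m)⁻¹) w₁ (u c) (c ^ m * deriv u c)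
      (G ∘ ext v b) r = ext u a r := fun r hr => by
    rw [hextE u a r hr]
    refine dop_rep m R c hc u (fun r => p r * g (v r)) w₁ _ u1 u2 ?_ (fun s hs => ?_) r hr
    · refine (hp.mono fun s hs => hs.1.le).mul (hgc.comp (hv.continuousOn.mono hIoo) fun s hs => ?_)
      exact (hpos s (hIoo s hs)).2.le
    · have h1 := hIoo s (hcI s hs)
      rw [Function.comp, hextE v b s hs, G5 _ (hpos s h1).2.le ((hN s h1).trans hNK.le), w₁e s hs.1, mul_assoc]
  have hrepV : ∀ r ∈ Ico c R, dop c (fun t => ((max t c) ^ m)⁻¹) w₂ (v c) (c ^ m * deriv v c)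
      (F ∘ ext u a) r = ext v b r := fun r hr => by
    rw [hextE v b r hr]
    refine dop_rep m R c hc v (fun r => q r * f (u r)) w₂ _ v1 v2 ?_ (fun s hs => ?_) r hr
    · refine (hq.mono fun s hs => hs.1.le).mul (hfc.comp (hu.continuousOn.mono hIoo) fun s hs => ?_)
      exact (hpos s (hIoo s hs)).1.le
    · have h1 := hIoo s (hcI s hs)
      rw [Function.comp, hextE u a s hs, F5 _ (hpos s h1).1.le ((hM s h1).trans hMK.le), w₂e s hs.1, mul_assoc]
  have hcm : 0 ≤ c ^ m := pow_nonneg hc.1.le m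
  obtain ⟨U, V, hUc, hVc, hUf, hVf, hU0, hV0, hUe, hVe⟩ := fixpt c R (fun t => ((max t c) ^ m)⁻¹) w₁ w₂ F G
    (ext u a) (ext v b) (u c) (c ^ m * deriv u c) (v c) (c ^ m * deriv v c) (max (f K) (g K))
    hkc w₁c w₂c hk0 w₁0 w₂0 F1 G1 F2 G2
    (fun s => by rw [abs_of_nonneg (F3 s)]; exact (F4 s).trans (le_max_left _ _))
    (fun s => by rw [abs_of_nonneg (G3 s)]; exact (G4 s).trans (le_max_right _ _))
    (hext u a hu.continuousOn) (hext v b hv.continuousOn)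
    (fun r => by
      by_cases hr : r ∈ Ico c R
      · rw [max_eq_left hr.1, hrepU r hr]
      · have h1 : ext u a r = a := if_neg hr
        rw [h1, ← hua]
        exact (u4 c (hIoo c hc)).trans (dop_ge hk0 w₁0 (fun s => G3 _)
          (mul_nonneg hcm (u3 c hc)) _ (le_max_right _ _)))
    (fun r => by
      by_cases hr : r ∈ Ico c R
      · rw [max_eq_left hr.1, hrepV r hr]
      · have h1 : ext v b r = b := if_neg hr
        rw [h1, ← hvb]
        exact (v4 c (hIoo c hc)).trans (dop_ge hk0 w₂0 (fun s => F3 _)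
          (mul_nonneg hcm (v3 c hc)) _ (le_max_right _ _)))
    hrepU hrepV
  have hUu : ∀ r ∈ Ico c R, U r = u r := fun r hr => (hUe r hr).trans (hextE u a r hr)
  have hVv : ∀ r ∈ Ico c R, V r = v r := fun r hr => (hVe r hr).trans (hextE v b r hr)
  have hle : ∀ (W : ℝ → ℝ) (C : ℝ), Continuous W → (∀ r ∈ Ico c R, W r ≤ C) → W R ≤ C := fun W C hW h => by
    have ht : Tendsto W (𝓝[<] R) (𝓝 (W R)) := hW.continuousAt.tendsto.mono_left nhdsWithin_le_nhds
    refine le_of_tendsto ht ?_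
    filter_upwards [Ico_mem_nhdsLT hc.2] with s hs using h s hs
  have hUR : U R < K := (hle U M hUc fun r hr => hUu r hr ▸ hM r (hIoo r (hcI r hr))).trans_lt hMK
  have hVR : V R < K := (hle V N hVc fun r hr => hVv r hr ▸ hN r (hIoo r (hcI r hr))).trans_lt hNK
  have hev : ∀ᶠ r in 𝓝 R, U r < K ∧ V r < K :=
    (hUc.continuousAt.eventually_lt_const hUR).and (hVc.continuousAt.eventually_lt_const hVR)
  obtain ⟨δ, hδ, hball⟩ := Metric.eventually_nhds_iff.1 hev
  have hall : ∀ r ∈ Ico c (R + δ), 0 < U r ∧ 0 < V r ∧ U r ≤ K ∧ V r ≤ K := fun r hr => by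
    rcases lt_or_ge r R with h | h
    · have h1 := hIoo r (hcI r ⟨hr.1, h⟩)
      rw [hUu r ⟨hr.1, h⟩, hVv r ⟨hr.1, h⟩]
      exact ⟨(hpos r h1).1, (hpos r h1).2, (hM r h1).trans hMK.le, (hN r h1).trans hNK.le⟩
    · have h1 : r ∉ Ico c R := fun h' => absurd h'.2 (not_lt.2 h)
      have h2 : ext u a r = a := if_neg h1
      have h3 : ext v b r = b := if_neg h1
      have h4 := hball (y := r) (by rw [Real.dist_eq, abs_of_nonneg (by linarith)]; linarith [hr.2])
      exact ⟨ha.trans_le (h2 ▸ hU0 r), hb.trans_le (h3 ▸ hV0 r), h4.1.le, h4.2.le⟩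
  have hρ : R < R + δ := by linarith
  have hif : ∀ (u U : ℝ → ℝ), (∀ r ∈ Ico c R, U r = u r) → ∃ Uf : ℝ → ℝ,
      (∀ r, r < R → Uf r = u r) ∧ (∀ r, c ≤ r → Uf r = U r) := fun u U h => by
    refine ⟨fun r => if r < c then u r else U r, fun r hr => ?_, fun r hr => if_neg (not_lt.2 hr)⟩
    by_cases h' : r < c
    · exact if_pos h'
    · exact (if_neg h').trans (h r ⟨not_lt.1 h', hr⟩)
  obtain ⟨Uf, Uf1, Uf2⟩ := hif u U hUu
  obtain ⟨Vf, Vf1, Vf2⟩ := hif v V hVv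
  have hUU : ∀ r ∈ Ioo c (R + δ), ContDiffAt ℝ 2 U r ∧
      deriv (deriv U) r + m / r * deriv U r = p r * g (Vf r) := fun r hr => by
    have h1 := dop_smooth m hm c _ _ hc.1 U w₁ (G ∘ V) w₁c (G1.comp hVc) hUf r hr.1
    refine ⟨h1.1, h1.2.trans ?_⟩
    obtain ⟨-, h2, -, h3⟩ := hall r ⟨hr.1.le, hr.2⟩
    have h4 := (pow_pos (hc.1.trans hr.1) m).ne'
    rw [Vf2 r hr.1.le, Function.comp, G5 _ h2.le h3, w₁e r hr.1.le]
    field_simp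
  have hVV : ∀ r ∈ Ioo c (R + δ), ContDiffAt ℝ 2 V r ∧
      deriv (deriv V) r + m / r * deriv V r = q r * f (Uf r) := fun r hr => by
    have h1 := dop_smooth m hm c _ _ hc.1 V w₂ (F ∘ U) w₂c (F1.comp hUc) hVf r hr.1
    refine ⟨h1.1, h1.2.trans ?_⟩
    obtain ⟨h2, -, h3, -⟩ := hall r ⟨hr.1.le, hr.2⟩
    have h4 := (pow_pos (hc.1.trans hr.1) m).ne'
    rw [Uf2 r hr.1.le, Function.comp, F5 _ h2.le h3, w₂e r hr.1.le]
    field_simp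
  obtain ⟨A1, A2, A3⟩ := glue m R c (R + δ) hc hρ u (fun r => p r * g (Vf r)) U Uf hu
    (fun r hr => by rw [Vf1 r hr.2]; exact (hode r hr).1) hdu hUU Uf1 (fun r hr => Uf2 r hr.le)
  obtain ⟨B1, B2, B3⟩ := glue m R c (R + δ) hc hρ v (fun r => q r * f (Uf r)) V Vf hv
    (fun r hr => by rw [Uf1 r hr.2]; exact (hode r hr).2) hdv hVV Vf1 (fun r hr => Vf2 r hr.le)
  refine ⟨δ, hδ, Uf, Vf, ⟨A1, B1, fun r hr => ?_, (Uf1 0 hR).trans hua, (Vf1 0 hR).trans hvb, A2, B2, ?_⟩,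
    fun r hr => Uf1 r hr.2, fun r hr => Vf1 r hr.2⟩
  · rcases lt_or_ge r R with h | h
    · rw [Uf1 r h, Vf1 r h]
      exact hpos r ⟨hr.1, h⟩
    · have hcr : c ≤ r := hc.2.le.trans h
      obtain ⟨h1, h2, -⟩ := hall r ⟨hcr, hr.2⟩
      rw [Uf2 r hcr, Vf2 r hcr]
      exact ⟨h1, h2⟩
  · intro r hr
    rw [hcast]
    exact ⟨A3 r hr, B3 r hr⟩
end
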